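/- arXiv:1805.11826 — 4 statements merged into one kernel-verified Lean document; each statement's English description precedes it below -/
import Mathlib

section
/- Let l be a natural number. In ℤ[[t]] define A = ∑_{(λ₁,λ₂)∈ℤ², λ₁>λ₂} t^{−2|λ₁−λ₂|+|λ₁−λ₂+l|+|λ₂−λ₁+l|+2l+|λ₁+l|+|λ₂+l|}, B = ∑_{λ∈ℤ} t^{4l+2|λ+l|}, and C = ∑_{m∈ℤ} t^{|l−m|+|m|}; in each case the exponent is a nonnegative integer and, for every n ∈ ℕ, the set of index tuples whose exponent equals n is finite, so A, B, C are well-defined power series. Then (1−t⁴)(1−t)²·A + (1−t²)(1−t)²·B = t^{2l}(1−t²)(1−t⁴)·C in ℤ[[t]]. (Equivalently, (1−t²)^{−2}A + (1−t²)^{−1}(1−t⁴)^{−1}B = t^{2l}(1−t²)^{−1}(1−t)^{−2}C; this is Lemma 'monopole Hilbert', matching the monopole formula for the GL(2) gauge theory with matter V ⊕ 𝔤𝔩(V) at flavor coweight l with the character of Γ(Hilb²(𝔸²), 𝓛^l).) -/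
/-- The exponent of the first sum in the monopole formula for the
`GL(2)` gauge theory with matter `V ⊕ 𝔤𝔩(V)` at flavor coweight `l`. -/
def expA (l : ℕ) (p : ℤ × ℤ) : ℤ :=
  -2 * |p.1 - p.2| + |p.1 - p.2 + l| + |p.2 - p.1 + l| + 2 * l + |p.1 + l| + |p.2 + l|

/-- The exponent of the second sum. -/
def expB (l : ℕ) (lam : ℤ) : ℤ := 4 * l + 2 * |lam + l|

/-- The exponent of the sum on the right-hand side. -/
def expC (l : ℕ) (m : ℤ) : ℤ := |(l : ℤ) - m| + |m|

/-- `A = ∑_{λ₁>λ₂} t^{expA}`, defined via fiber counting. -/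
noncomputable def serA (l : ℕ) : PowerSeries ℤ :=
  PowerSeries.mk fun n =>
    (Set.ncard {p : ℤ × ℤ | p.1 > p.2 ∧ expA l p = n} : ℤ)

/-- `B = ∑_{λ∈ℤ} t^{expB}`, defined via fiber counting. -/
noncomputable def serB (l : ℕ) : PowerSeries ℤ :=
  PowerSeries.mk fun n => (Set.ncard {lam : ℤ | expB l lam = n} : ℤ)

/-- `C = ∑_{m∈ℤ} t^{expC}`, defined via fiber counting. -/
noncomputable def serC (l : ℕ) : PowerSeries ℤ :=
  PowerSeries.mk fun n => (Set.ncard {m : ℤ | expC l m = n} : ℤ)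

lemma finC (l n : ℕ) : {m : ℤ | expC l m = n}.Finite := by
  apply (Set.finite_Icc (-(n:ℤ)) n).subset
  intro m hm
  simp only [Set.mem_ofPred_eq, expC, Set.mem_Icc] at *
  grind

lemma finB (l n : ℕ) : {m : ℤ | expB l m = n}.Finite := by
  apply (Set.finite_Icc (-(n:ℤ) - l) n).subset
  intro m hm
  simp only [Set.mem_ofPred_eq, expB, Set.mem_Icc] at *
  grind

lemma finA (l n : ℕ) : {p : ℤ × ℤ | p.1 > p.2 ∧ expA l p = n}.Finite := by
  apply ((Set.finite_Icc (-(n:ℤ) - l) n).prod (Set.finite_Icc (-(n:ℤ) - l) n)).subset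
  rintro ⟨a, b⟩ hm
  simp only [Set.mem_ofPred_eq, expA, Set.mem_prod, Set.mem_Icc] at *
  grind

lemma cardC (d n : ℕ) : (Set.ncard {m : ℤ | expC d m = n} : ℤ) =
    if n = d then (d:ℤ) + 1 else if d < n ∧ (n - d) % 2 = 0 then 2 else 0 := by
  split_ifs with h1 h2
  · have : {m : ℤ | expC d m = n} = ((Finset.Icc (0:ℤ) d : Finset ℤ) : Set ℤ) := by
      ext m
      simp only [Set.mem_ofPred_eq, expC, Finset.coe_Icc, Set.mem_Icc]
      grind
    rw [this, Set.ncard_coe_finset, Int.card_Icc]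
    omega
  · obtain ⟨k, hk⟩ : ∃ k : ℕ, n = d + 2 * k := ⟨(n - d) / 2, by omega⟩
    have : {m : ℤ | expC d m = n} = {-(k:ℤ), (d:ℤ) + k} := by
      ext m
      simp only [Set.mem_ofPred_eq, expC, Set.mem_insert_iff, Set.mem_singleton_iff]
      grind
    rw [this, Set.ncard_pair (by omega)]
    rfl
  · have : {m : ℤ | expC d m = n} = ∅ := by
      ext m
      simp only [Set.mem_ofPred_eq, expC, Set.mem_empty_iff_false]
      grind
    rw [this]; simp

open PowerSeries in
lemma serC_closed (d : ℕ) : (1 - X ^ 2) * serC d =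
    X ^ d * ((d : PowerSeries ℤ) * (1 - X ^ 2) + 1 + X ^ 2) := by
  have h : X ^ d * ((d : PowerSeries ℤ) * (1 - X ^ 2) + 1 + X ^ 2) =
      C ((d:ℤ) + 1) * X ^ d + C (1 - (d:ℤ)) * X ^ (d + 2) := by
    simp only [map_add, map_sub, map_one, map_natCast]
    ring
  rw [h, sub_mul, one_mul]
  ext n
  rw [map_sub (coeff n), map_add (coeff n)]
  simp only [coeff_X_pow_mul', coeff_C_mul, coeff_X_pow, serC, coeff_mk, cardC]
  clear h
  split_ifs <;> grind

open PowerSeries in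
lemma serB_eq (l : ℕ) : serB l = X ^ (4 * l) * serC 0 := by
  ext n
  simp only [coeff_X_pow_mul', serC, serB, coeff_mk]
  split_ifs with h
  · have : {m : ℤ | expC 0 m = (n - 4 * l : ℕ)} = (fun x : ℤ => x + l) '' {m : ℤ | expB l m = n} := by
      ext m
      simp only [Set.mem_ofPred_eq, expC, expB, Set.mem_image]
      constructor
      · intro h
        refine ⟨m - l, ?_, by ring⟩
        grind
      · rintro ⟨x, hx, rfl⟩
        grind
    rw [this, Set.ncard_image_of_injective _ (add_left_injective _)]
  · have : {m : ℤ | expB l m = n} = ∅ := by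
      ext m
      simp only [Set.mem_ofPred_eq, expB, Set.mem_empty_iff_false]
      grind
    rw [this]; simp

open PowerSeries in
lemma cardAd (l d n : ℕ) (hd : 1 ≤ d) :
    (Set.ncard {p : ℤ × ℤ | p.1 - p.2 = d ∧ expA l p = n} : ℤ) =
      coeff n (X ^ (2 * l + 2 * (l - d)) * serC d) := by
  simp only [coeff_X_pow_mul', serC, coeff_mk]
  split_ifs with h
  · have : {p : ℤ × ℤ | p.1 - p.2 = d ∧ expA l p = n} = (fun x : ℤ => (x - l, x - d - l)) ''
        {m : ℤ | expC d m = (n - (2 * l + 2 * (l - d)) : ℕ)} := by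
      ext ⟨a, b⟩
      simp only [Set.mem_ofPred_eq, expC, expA, Set.mem_image, Prod.mk.injEq]
      constructor
      · rintro ⟨h1, h2⟩
        refine ⟨a + l, ?_, by ring, by omega⟩
        grind
      · rintro ⟨x, hx, rfl, rfl⟩
        refine ⟨by ring, ?_⟩
        grind
    rw [this, Set.ncard_image_of_injective]
    intro x y hxy
    simp only [Prod.mk.injEq] at hxy
    omega
  · have : {p : ℤ × ℤ | p.1 - p.2 = d ∧ expA l p = n} = ∅ := by
      ext ⟨a, b⟩
      simp only [Set.mem_ofPred_eq, expA, Set.mem_empty_iff_false]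
      grind
    rw [this]; simp

open PowerSeries in
lemma coeffA (l n N : ℕ) (hN : n ≤ N) : coeff n (serA l) =
    coeff n (∑ d ∈ Finset.Icc 1 N, X ^ (2 * l + 2 * (l - d)) * serC d) := by
  rw [map_sum, serA, coeff_mk]
  rw [← Finset.sum_congr rfl (fun d hd => cardAd l d n (Finset.mem_Icc.1 hd).1)]
  rw [Set.ncard_eq_toFinset_card _ (finA l n)]
  rw [Finset.card_eq_sum_card_fiberwise (f := fun p : ℤ × ℤ => (p.1 - p.2).toNat)
    (t := Finset.Icc 1 N)]
  · push_cast
    apply Finset.sum_congr rfl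
    intro d hd
    rw [← Set.ncard_coe_finset]
    congr 2
    ext ⟨a, b⟩
    simp only [Finset.mem_Icc] at hd
    simp only [Finset.coe_filter, Set.Finite.mem_toFinset, Set.mem_ofPred_eq]
    constructor
    · rintro ⟨⟨h1, h2⟩, h3⟩
      exact ⟨by omega, h2⟩
    · rintro ⟨h1, h2⟩
      exact ⟨⟨by omega, h2⟩, by omega⟩
  · rintro ⟨a, b⟩ hp
    simp only [Finset.mem_coe, Set.Finite.mem_toFinset, Set.mem_ofPred_eq, expA, Finset.mem_Icc] at *
    grind

open PowerSeries in
lemma headSum (l : ℕ) : (1 - X) ^ 2 * ((1 - X ^ 2) *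
      ∑ d ∈ Finset.Icc 1 l, X ^ (2 * (l - d)) * serC d) =
    X ^ l * ((l : PowerSeries ℤ) * (1 - X) * (1 - X ^ 2) + (1 - X) ^ 2)
      - (1 - X) ^ 2 * X ^ (2 * l) := by
  induction l with
  | zero => simp
  | succ l ih =>
    rw [Finset.sum_Icc_succ_top (by omega)]
    have : ∑ d ∈ Finset.Icc 1 l, X ^ (2 * (l + 1 - d)) * serC d =
        X ^ 2 * ∑ d ∈ Finset.Icc 1 l, X ^ (2 * (l - d)) * serC d := by
      rw [Finset.mul_sum]
      apply Finset.sum_congr rfl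
      intro d hd
      rw [Finset.mem_Icc] at hd
      rw [show 2 * (l + 1 - d) = 2 + 2 * (l - d) by omega, pow_add, mul_assoc]
    rw [this]
    have h := serC_closed (l + 1)
    simp only [Nat.sub_self, mul_zero, pow_zero, one_mul]
    push_cast at h ⊢
    linear_combination X ^ 2 * ih + (1 - X) ^ 2 * h

open PowerSeries in
noncomputable def gg (l : ℕ) : PowerSeries ℤ :=
  X ^ l * ((l : PowerSeries ℤ) * (X * (1 - X) * (1 - X ^ 2)) + X ^ 2 * (1 - X ^ 2) + 2 * X * (1 - X))

open PowerSeries in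
lemma fullSum (l k : ℕ) : (1 - X) ^ 2 * ((1 - X ^ 2) *
      ∑ d ∈ Finset.Icc 1 (l + k), X ^ (2 * (l - d)) * serC d) =
    X ^ l * ((l : PowerSeries ℤ) * (1 - X) * (1 - X ^ 2) + (1 - X) ^ 2)
      - (1 - X) ^ 2 * X ^ (2 * l) + gg l - gg (l + k) := by
  induction k with
  | zero => simp [headSum]
  | succ k ih =>
    rw [← add_assoc, Finset.sum_Icc_succ_top (by omega),
      show l - (l + k + 1) = 0 by omega]
    have h := serC_closed (l + k + 1)
    have e : gg (l + k) - gg (l + k + 1) = (1 - X) ^ 2 * (X ^ (l + k + 1) *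
      (((l + k + 1 : ℕ) : PowerSeries ℤ) * (1 - X ^ 2) + 1 + X ^ 2)) := by
      simp only [gg]
      push_cast
      ring
    simp only [mul_zero, pow_zero, one_mul]
    linear_combination ih + (1 - X) ^ 2 * h - e

open PowerSeries in
lemma main_dvd (l n : ℕ) : (X : PowerSeries ℤ) ^ n ∣ (1 - X ^ 2) *
    ((1 - X ^ 4) * (1 - X) ^ 2 * serA l + (1 - X ^ 2) * (1 - X) ^ 2 * serB l
      - X ^ (2 * l) * (1 - X ^ 2) * (1 - X ^ 4) * serC l) := by
  have h1 : (X : PowerSeries ℤ) ^ n ∣ serA l -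
      ∑ d ∈ Finset.Icc 1 (l + n), X ^ (2 * l + 2 * (l - d)) * serC d := by
    rw [X_pow_dvd_iff]
    intro m hm
    rw [map_sub, coeffA l m (l + n) (by omega), sub_self]
  obtain ⟨q, hq⟩ := h1
  have h2 : ∑ d ∈ Finset.Icc 1 (l + n), X ^ (2 * l + 2 * (l - d)) * serC d =
      X ^ (2 * l) * ∑ d ∈ Finset.Icc 1 (l + n), X ^ (2 * (l - d)) * serC d := by
    rw [Finset.mul_sum]
    exact Finset.sum_congr rfl fun d _ => by rw [pow_add, mul_assoc]
  rw [h2] at hq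
  have h3 := fullSum l n
  have hC := serC_closed l
  have h0 := serC_closed 0
  have hB := serB_eq l
  obtain ⟨r, hr⟩ : (X : PowerSeries ℤ) ^ n ∣ gg (l + n) := by
    rw [gg, pow_add, mul_comm (X ^ l), mul_assoc]
    exact Dvd.intro _ rfl
  rw [hr] at h3
  refine ⟨(1 - X ^ 2) * (1 - X ^ 4) * (1 - X) ^ 2 * q - (1 - X ^ 4) * X ^ (2 * l) * r, ?_⟩
  rw [hB]
  simp only [gg] at h3
  push_cast at h0
  linear_combination (1 - X ^ 2) * (1 - X ^ 4) * (1 - X) ^ 2 * hq + (1 - X ^ 4) * X ^ (2 * l) * h3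
    - X ^ (2 * l) * (1 - X ^ 2) * (1 - X ^ 4) * hC
    + (1 - X ^ 2) * (1 - X) ^ 2 * X ^ (4 * l) * h0

open PowerSeries in
theorem stmt0 (l : ℕ) :
    (∀ p : ℤ × ℤ, p.1 > p.2 → 0 ≤ expA l p) ∧
    (∀ n : ℕ, {p : ℤ × ℤ | p.1 > p.2 ∧ expA l p = n}.Finite) ∧
    (∀ lam : ℤ, 0 ≤ expB l lam) ∧
    (∀ n : ℕ, {lam : ℤ | expB l lam = n}.Finite) ∧
    (∀ m : ℤ, 0 ≤ expC l m) ∧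
    (∀ n : ℕ, {m : ℤ | expC l m = n}.Finite) ∧
    (1 - X ^ 4) * (1 - X) ^ 2 * serA l + (1 - X ^ 2) * (1 - X) ^ 2 * serB l
      = X ^ (2 * l) * (1 - X ^ 2) * (1 - X ^ 4) * serC l := by
  refine ⟨?_, finA l, ?_, finB l, ?_, finC l, ?_⟩
  · rintro ⟨a, b⟩ h
    simp only [expA] at *
    grind
  · intro m
    simp only [expB]
    positivity
  · intro m
    simp only [expC]
    positivity
  · have hz : (1 - X ^ 2) *
      ((1 - X ^ 4) * (1 - X) ^ 2 * serA l + (1 - X ^ 2) * (1 - X) ^ 2 * serB l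
      - X ^ (2 * l) * (1 - X ^ 2) * (1 - X ^ 4) * serC l) = 0 := by
      ext n
      rw [X_pow_dvd_iff.1 (main_dvd l (n + 1)) n (by omega), map_zero]
    have hne : (1 - X ^ 2 : PowerSeries ℤ) ≠ 0 := by
      intro h
      have := congrArg (coeff 0) h
      simp [coeff_X_pow] at this
    exact sub_eq_zero.1 ((mul_eq_zero.1 hz).resolve_left hne)
end

section
/- Let l ≥ 1 be an integer and set E(λ₁,λ₂) = −2|λ₁−λ₂| + |λ₁−λ₂+l| + |λ₂−λ₁+l| + 2l + |λ₁+l| + |λ₂+l|. On the region R = {(λ₁,λ₂) ∈ ℤ² : −l ≥ λ₁ > λ₂ and λ₁−λ₂ ≥ l}, the values E(λ₁,λ₂) are nonnegative, each fiber of E over n ∈ ℕ is finite, and in ℤ[[t]] one has (1−t²)(1−t)·∑_{(λ₁,λ₂)∈R} t^{E(λ₁,λ₂)} = t^{3l}, i.e. the partial sum over R equals t^{3l}/((1−t²)(1−t)). (This is one of the six partial summations in the proof of Lemma 'monopole Hilbert'.) -/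
/-- The region `R = {(λ₁,λ₂) : −l ≥ λ₁ > λ₂, λ₁−λ₂ ≥ l}`. -/
def regionR (l : ℕ) : Set (ℤ × ℤ) :=
  {p : ℤ × ℤ | -(l : ℤ) ≥ p.1 ∧ p.1 > p.2 ∧ p.1 - p.2 ≥ l}

theorem expA_eq (l : ℕ) (p : ℤ × ℤ) (hp : p ∈ regionR l) : expA l p = - p.1 - p.2 := by
  obtain ⟨h1, h2, h3⟩ := hp
  unfold expA
  rw [abs_of_nonneg (show 0 ≤ p.1 - p.2 by omega),
    abs_of_nonneg (show 0 ≤ p.1 - p.2 + l by omega),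
    abs_of_nonpos (show p.2 - p.1 + l ≤ 0 by omega),
    abs_of_nonpos (show p.1 + l ≤ 0 by omega),
    abs_of_nonpos (show p.2 + l ≤ 0 by omega)]
  ring

theorem fiber_eq (l : ℕ) (hl : 1 ≤ l) (n : ℕ) :
    {p : ℤ × ℤ | p ∈ regionR l ∧ expA l p = n} =
      (((Finset.range ((n + 2 - 3 * l) / 2)).image
        (fun a : ℕ => ((-(l : ℤ) - a, (l : ℤ) + a - n) : ℤ × ℤ)) : Finset (ℤ × ℤ)) :
          Set (ℤ × ℤ)) := by
  ext ⟨x, y⟩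
  simp only [Set.mem_setOf_eq, Finset.coe_image, Set.mem_image, Finset.coe_range, Set.mem_Iio,
    Prod.mk.injEq]
  constructor
  · rintro ⟨hp, he⟩
    rw [expA_eq l _ hp] at he
    obtain ⟨h1, h2, h3⟩ := hp
    simp only at h1 h2 h3 he
    exact ⟨(-(l : ℤ) - x).toNat, by omega, by omega, by omega⟩
  · rintro ⟨a, ha, rfl, rfl⟩
    have hp : ((-(l : ℤ) - a, (l : ℤ) + a - n) : ℤ × ℤ) ∈ regionR l := by
      refine ⟨?_, ?_, ?_⟩ <;> simp only <;> omega
    refine ⟨hp, ?_⟩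
    rw [expA_eq l _ hp]
    ring

theorem fiber_ncard (l : ℕ) (hl : 1 ≤ l) (n : ℕ) :
    Set.ncard {p : ℤ × ℤ | p ∈ regionR l ∧ expA l p = n} = (n + 2 - 3 * l) / 2 := by
  rw [fiber_eq l hl n, Set.ncard_coe_finset, Finset.card_image_of_injective, Finset.card_range]
  intro a b h
  simp only [Prod.mk.injEq] at h
  omega

open PowerSeries in
theorem stmt2 (l : ℕ) (hl : 1 ≤ l) :
    (∀ p ∈ regionR l, 0 ≤ expA l p) ∧
    (∀ n : ℕ, {p : ℤ × ℤ | p ∈ regionR l ∧ expA l p = n}.Finite) ∧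
    (1 - X ^ 2) * (1 - X) *
      PowerSeries.mk (fun n => (Set.ncard {p : ℤ × ℤ | p ∈ regionR l ∧ expA l p = n} : ℤ))
      = X ^ (3 * l) := by
  refine ⟨?_, ?_, ?_⟩
  · intro p hp
    rw [expA_eq l p hp]
    obtain ⟨h1, h2, h3⟩ := hp
    omega
  · intro n
    rw [fiber_eq l hl n]
    exact Finset.finite_toSet _
  · simp only [fiber_ncard l hl]
    have e : ∀ f : PowerSeries ℤ, (1 - X ^ 2) * (1 - X) * f
        = f - X ^ 1 * f - X ^ 2 * f + X ^ 3 * f := by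
      intro f; ring
    rw [e]
    ext n
    simp only [map_add, map_sub, coeff_X_pow_mul', coeff_mk, coeff_X_pow]
    split_ifs <;> omega
end

section
/- Let N ≥ 2 and let λ₁ ≥ λ₂ ≥ … ≥ λ_N be integers. Fix n with 1 ≤ n ≤ N−1 and define ω ∈ ℤ^N by ωᵢ = 1 for i ≤ n and ωᵢ = 0 for i > n. Then for every integer m there exist integers m′ and m″ with m″ ∈ {0,1}, m = m′ + m″, and ∑_{i=1}^N |λᵢ + ωᵢ − m| = ∑_{i=1}^N |λᵢ − m′| + ∑_{i=1}^N |ωᵢ − m″|. (Explicitly, if m ≥ λₙ + 1 one may take m′ = m−1, m″ = 1, and if m ≤ λₙ one may take m′ = m, m″ = 0. This is the combinatorial identity underlying the surjectivity of the multiplication morphism Γ(𝒮_N,ℱ_λ) ⊗ Γ(𝒮_N,ℱ_{ω_n}) → Γ(𝒮_N,ℱ_{λ+ω_n}) of Lemma 'tensor surj', via the multiplicity-free monopole character.) -/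
/-- The combinatorial identity underlying the surjectivity of the multiplication
morphism `Γ(𝒮_N,ℱ_λ) ⊗ Γ(𝒮_N,ℱ_{ω_n}) → Γ(𝒮_N,ℱ_{λ+ω_n})` (Lemma `tensor surj`):
for a nonincreasing integer sequence `λ₁ ≥ … ≥ λ_N` and the fundamental weight
`ω = ω_n` (with `n` ones), every `m ∈ ℤ` decomposes as `m = m′ + m″` with
`m″ ∈ {0,1}` and `∑|λᵢ+ωᵢ−m| = ∑|λᵢ−m′| + ∑|ωᵢ−m″|`. -/
theorem stmt5 (N : ℕ) (hN : 2 ≤ N) (lam : Fin N → ℤ) (hlam : Antitone lam)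
    (n : ℕ) (hn1 : 1 ≤ n) (hn2 : n ≤ N - 1)
    (ω : Fin N → ℤ) (hω : ∀ i : Fin N, ω i = if (i : ℕ) < n then 1 else 0) :
    ∀ m : ℤ, ∃ m' m'' : ℤ, (m'' = 0 ∨ m'' = 1) ∧ m = m' + m'' ∧
      (∑ i, |lam i + ω i - m|) = (∑ i, |lam i - m'|) + (∑ i, |ω i - m''|) := by
  intro m
  have hk : n - 1 < N := by omega
  by_cases h : m ≤ lam ⟨n - 1, hk⟩
  · refine ⟨m, 0, Or.inl rfl, by ring, ?_⟩
    rw [← Finset.sum_add_distrib]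
    refine Finset.sum_congr rfl fun i _ => ?_
    rw [hω i]
    split_ifs with hi
    · have h1 : lam ⟨n - 1, hk⟩ ≤ lam i := hlam (Fin.le_def.2 (by simp only; omega))
      rw [abs_of_nonneg (by omega : 0 ≤ lam i + 1 - m),
        abs_of_nonneg (by omega : 0 ≤ lam i - m)]
      norm_num
      ring
    · simp
  · refine ⟨m - 1, 1, Or.inr rfl, by ring, ?_⟩
    rw [← Finset.sum_add_distrib]
    refine Finset.sum_congr rfl fun i _ => ?_
    rw [hω i]
    split_ifs with hi
    · rw [sub_self, abs_zero, add_zero]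
      congr 1
      ring
    · have h1 : lam i ≤ lam ⟨n - 1, hk⟩ := hlam (Fin.le_def.2 (by simp only; omega))
      rw [abs_of_nonpos (by omega : lam i + 0 - m ≤ 0),
        abs_of_nonpos (by omega : lam i - (m - 1) ≤ 0)]
      norm_num
      ring
end

section
/- Fix natural numbers p and q. Let R be the quotient of the polynomial ring ℂ[w_i, w_j, y_i, y_j, y_{ji}, z_i, z_j, z_{ji}] by the ideal generated by the nine elements: z_j z_i − (w_i−w_j) z_{ji}, y_j y_i − (w_i−w_j) y_{ji}, z_{ji} y_{ji} − w_i^p w_j^q, z_i y_i − (w_i−w_j) w_i^p, z_j y_j − (w_i−w_j) w_j^q, z_i y_{ji} − w_i^p y_j, z_j y_{ji} − w_j^q y_i, y_i z_{ji} − w_i^p z_j, y_j z_{ji} − w_j^q z_i. Let S be the quotient of ℂ[w_i, w_j, y_i, y_j, y_{ji}] by the single relation y_j y_i − (w_i−w_j) y_{ji}. Then the localization of R at the element w_i w_j is isomorphic as a ℂ-algebra to the localization of S at the element w_i w_j y_{ji}, via the map fixing w_i, w_j, y_i, y_j, y_{ji} and sending z_i ↦ w_i^p y_j y_{ji}^{−1},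 z_j ↦ w_j^q y_i y_{ji}^{−1}, z_{ji} ↦ w_i^p w_j^q y_{ji}^{−1}. (In particular y_{ji} becomes invertible after inverting w_i w_j, since z_{ji} y_{ji} = w_i^p w_j^q. This is the identification of the local model of the Coulomb branch 𝓜₀ over the locus w_i, w_j ≠ 0 in Section 'Computation'.) -/
open MvPolynomial

set_option synthInstance.maxHeartbeats 1000000
set_option maxHeartbeats 1000000

noncomputable section

/-- Variables: `0 = wᵢ`, `1 = wⱼ`, `2 = yᵢ`, `3 = yⱼ`, `4 = yⱼᵢ`, `5 = zᵢ`,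
`6 = zⱼ`, `7 = zⱼᵢ`.  The nine defining relations of the local model `R`. -/
def bowRels (p q : ℕ) : Set (MvPolynomial (Fin 8) ℂ) :=
  { X 6 * X 5 - (X 0 - X 1) * X 7,
    X 3 * X 2 - (X 0 - X 1) * X 4,
    X 7 * X 4 - X 0 ^ p * X 1 ^ q,
    X 5 * X 2 - (X 0 - X 1) * X 0 ^ p,
    X 6 * X 3 - (X 0 - X 1) * X 1 ^ q,
    X 5 * X 4 - X 0 ^ p * X 3,
    X 6 * X 4 - X 1 ^ q * X 2,
    X 2 * X 7 - X 0 ^ p * X 6,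
    X 3 * X 7 - X 1 ^ q * X 5 }

/-- `R = ℂ[wᵢ, wⱼ, yᵢ, yⱼ, yⱼᵢ, zᵢ, zⱼ, zⱼᵢ]/(nine relations)`. -/
abbrev BowR (p q : ℕ) : Type :=
  MvPolynomial (Fin 8) ℂ ⧸ Ideal.span (bowRels p q)

/-- The class in `R` of a polynomial. -/
def bowMk (p q : ℕ) (a : MvPolynomial (Fin 8) ℂ) : BowR p q :=
  Ideal.Quotient.mk (Ideal.span (bowRels p q)) a

/-- The single relation `yⱼ yᵢ − (wᵢ−wⱼ) yⱼᵢ` defining `S`.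
Variables: `0 = wᵢ`, `1 = wⱼ`, `2 = yᵢ`, `3 = yⱼ`, `4 = yⱼᵢ`. -/
def sRel : Set (MvPolynomial (Fin 5) ℂ) := {X 3 * X 2 - (X 0 - X 1) * X 4}

/-- `S = ℂ[wᵢ, wⱼ, yᵢ, yⱼ, yⱼᵢ]/(yⱼ yᵢ − (wᵢ−wⱼ) yⱼᵢ)`. -/
abbrev BowS : Type := MvPolynomial (Fin 5) ℂ ⧸ Ideal.span sRel

/-- The class in `S` of a polynomial. -/
def sMk (a : MvPolynomial (Fin 5) ℂ) : BowS :=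
  Ideal.Quotient.mk (Ideal.span sRel) a

/-- The composite `ℂ[w,…] → R → R[(wᵢwⱼ)⁻¹]`. -/
def toLocR (p q : ℕ) :
    MvPolynomial (Fin 8) ℂ →+* Localization.Away (bowMk p q (X 0 * X 1)) :=
  (algebraMap (BowR p q) (Localization.Away (bowMk p q (X 0 * X 1)))).comp
    (Ideal.Quotient.mk (Ideal.span (bowRels p q)))

/-- The composite `ℂ[wᵢ,wⱼ,yᵢ,yⱼ,yⱼᵢ] → S → S[(wᵢwⱼyⱼᵢ)⁻¹]`. -/
def toLocS :
    MvPolynomial (Fin 5) ℂ →+* Localization.Away (sMk (X 0 * X 1 * X 4)) :=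
  (algebraMap BowS (Localization.Away (sMk (X 0 * X 1 * X 4)))).comp
    (Ideal.Quotient.mk (Ideal.span sRel))

theorem lift_gen {P A : Type} [CommRing P] [CommRing A] (r : Set P) (a : P) (f : P →+* A)
    (hr : ∀ x ∈ r, f x = 0) (ha : IsUnit (f a)) :
    ∃ g : Localization.Away (Ideal.Quotient.mk (Ideal.span r) a) →+* A,
      ∀ x, g (algebraMap _ _ (Ideal.Quotient.mk (Ideal.span r) x)) = f x := by
  have h1 : ∀ x ∈ Ideal.span r, f x = 0 := by
    have : Ideal.span r ≤ RingHom.ker f := Ideal.span_le.2 fun x hx => hr x hx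
    exact fun x hx => this hx
  have h2 : IsUnit ((Ideal.Quotient.lift (Ideal.span r) f h1)
      (Ideal.Quotient.mk (Ideal.span r) a)) := by simpa using ha
  refine ⟨IsLocalization.Away.lift (Ideal.Quotient.mk (Ideal.span r) a) h2, fun x => ?_⟩
  rw [IsLocalization.Away.lift_eq]
  simp

theorem ext_gen {P A : Type} [CommRing P] [CommRing A] (r : Set P) (a : P)
    (g h : Localization.Away (Ideal.Quotient.mk (Ideal.span r) a) →+* A)
    (H : ∀ x, g (algebraMap _ _ (Ideal.Quotient.mk (Ideal.span r) x)) =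
      h (algebraMap _ _ (Ideal.Quotient.mk (Ideal.span r) x))) : g = h := by
  apply IsLocalization.ringHom_ext (Submonoid.powers (Ideal.Quotient.mk (Ideal.span r) a))
  apply Ideal.Quotient.ringHom_ext
  ext x
  exact H x

theorem liftR (p q : ℕ) {A : Type} [CommRing A] (f : MvPolynomial (Fin 8) ℂ →+* A)
    (hr : ∀ x ∈ bowRels p q, f x = 0) (ha : IsUnit (f (X 0 * X 1))) :
    ∃ g : Localization.Away (bowMk p q (X 0 * X 1)) →+* A, ∀ x, g (toLocR p q x) = f x :=
  lift_gen _ _ f hr ha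

theorem liftS {A : Type} [CommRing A] (f : MvPolynomial (Fin 5) ℂ →+* A)
    (hr : ∀ x ∈ sRel, f x = 0) (ha : IsUnit (f (X 0 * X 1 * X 4))) :
    ∃ g : Localization.Away (sMk (X 0 * X 1 * X 4)) →+* A, ∀ x, g (toLocS x) = f x :=
  lift_gen _ _ f hr ha

theorem extR (p q : ℕ) {A : Type} [CommRing A]
    (g h : Localization.Away (bowMk p q (X 0 * X 1)) →+* A)
    (H : g.comp (toLocR p q) = h.comp (toLocR p q)) : g = h :=
  ext_gen _ _ g h fun x => RingHom.congr_fun H x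

theorem extS {A : Type} [CommRing A]
    (g h : Localization.Away (sMk (X 0 * X 1 * X 4)) →+* A)
    (H : g.comp toLocS = h.comp toLocS) : g = h :=
  ext_gen _ _ g h fun x => RingHom.congr_fun H x

theorem relR (p q : ℕ) (x) (hx : x ∈ bowRels p q) : toLocR p q x = 0 := by
  have : Ideal.Quotient.mk (Ideal.span (bowRels p q)) x = 0 :=
    Ideal.Quotient.eq_zero_iff_mem.2 (Ideal.subset_span hx)
  simp [toLocR, this]

theorem relS (x) (hx : x ∈ sRel) : toLocS x = 0 := by
  have : Ideal.Quotient.mk (Ideal.span sRel) x = 0 :=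
    Ideal.Quotient.eq_zero_iff_mem.2 (Ideal.subset_span hx)
  simp [toLocS, this]

theorem unitR (p q : ℕ) : IsUnit (toLocR p q (X 0 * X 1)) :=
  IsLocalization.Away.algebraMap_isUnit (bowMk p q (X 0 * X 1))

theorem unitS : IsUnit (toLocS (X 0 * X 1 * X 4)) :=
  IsLocalization.Away.algebraMap_isUnit (sMk (X 0 * X 1 * X 4))

/-- Abstract form of the main argument. -/
theorem main_gen (p q : ℕ) {A B : Type} [CommRing A] [CommRing B]
    (a : MvPolynomial (Fin 8) ℂ →+* A) (b : MvPolynomial (Fin 5) ℂ →+* B)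
    (liftA : ∀ f : MvPolynomial (Fin 8) ℂ →+* B, (∀ x ∈ bowRels p q, f x = 0) →
      IsUnit (f (X 0 * X 1)) → ∃ g : A →+* B, ∀ x, g (a x) = f x)
    (liftB : ∀ f : MvPolynomial (Fin 5) ℂ →+* A, (∀ x ∈ sRel, f x = 0) →
      IsUnit (f (X 0 * X 1 * X 4)) → ∃ g : B →+* A, ∀ x, g (b x) = f x)
    (extA : ∀ g h : A →+* A, g.comp a = h.comp a → g = h)
    (extB : ∀ g h : B →+* B, g.comp b = h.comp b → g = h)
    (relA : ∀ x ∈ bowRels p q, a x = 0) (relB : ∀ x ∈ sRel, b x = 0)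
    (uA : IsUnit (a (X 0 * X 1))) (uB : IsUnit (b (X 0 * X 1 * X 4))) :
    ∃ e : A ≃+* B,
      (∀ c : ℂ, e (a (C c)) = b (C c)) ∧
      e (a (X 0)) = b (X 0) ∧
      e (a (X 1)) = b (X 1) ∧
      e (a (X 2)) = b (X 2) ∧
      e (a (X 3)) = b (X 3) ∧
      e (a (X 4)) = b (X 4) ∧
      e (a (X 5)) * b (X 4) = b (X 0) ^ p * b (X 3) ∧
      e (a (X 6)) * b (X 4) = b (X 1) ^ q * b (X 2) ∧
      e (a (X 7)) * b (X 4) = b (X 0) ^ p * b (X 1) ^ q := by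
  simp only [map_mul, IsUnit.mul_iff] at uA uB
  obtain ⟨uA0, uA1⟩ := uA
  obtain ⟨⟨uB0, uB1⟩, uB4⟩ := uB
  obtain ⟨v, hv⟩ := uB4.exists_right_inv
  have rB : b (X 3) * b (X 2) - (b (X 0) - b (X 1)) * b (X 4) = 0 := by
    simpa using relB _ rfl
  have relA' := relA
  simp only [bowRels, Set.mem_insert_iff, Set.mem_singleton_iff, forall_eq_or_imp, forall_eq,
    map_sub, map_mul, map_pow] at relA'
  obtain ⟨r1, r2, r3, r4, r5, r6, r7, r8, r9⟩ := relA'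
  have uA4 : IsUnit (a (X 4)) := by
    have : IsUnit (a (X 7) * a (X 4)) := by
      rw [sub_eq_zero.1 r3]; exact (uA0.pow p).mul (uA1.pow q)
    exact (IsUnit.mul_iff.1 this).2
  obtain ⟨f, hf⟩ := liftA (eval₂Hom (b.comp C) ![b (X 0), b (X 1), b (X 2), b (X 3), b (X 4),
      b (X 0) ^ p * b (X 3) * v, b (X 1) ^ q * b (X 2) * v, b (X 0) ^ p * b (X 1) ^ q * v])
    (by
      simp only [bowRels, Set.mem_insert_iff, Set.mem_singleton_iff, forall_eq_or_imp, forall_eq,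
        map_sub, map_mul, map_pow, eval₂Hom_X']
      simp only [Matrix.cons_val]
      generalize b (X 0) = w0 at *
      generalize b (X 1) = w1 at *
      generalize b (X 2) = y2 at *
      generalize b (X 3) = y3 at *
      generalize b (X 4) = y4 at *
      generalize w0 ^ p = P at *
      generalize w1 ^ q = Q at *
      refine ⟨?_, ?_, ?_, ?_, ?_, ?_, ?_, ?_, ?_⟩
      · linear_combination P * Q * v ^ 2 * rB + P * Q * v * (w0 - w1) * hv
      · linear_combination rB
      · linear_combination P * Q * hv
      · linear_combination P * v * rB + P * (w0 - w1) * hv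
      · linear_combination Q * v * rB + Q * (w0 - w1) * hv
      · linear_combination P * y3 * hv
      · linear_combination Q * y2 * hv
      · ring
      · ring)
    (by simpa using ⟨uB0, uB1⟩)
  obtain ⟨g, hg⟩ := liftB (eval₂Hom (a.comp C) ![a (X 0), a (X 1), a (X 2), a (X 3), a (X 4)])
    (by simpa [sRel] using r2)
    (by simpa using ⟨⟨uA0, uA1⟩, uA4⟩)
  have fC : ∀ c, f (a (C c)) = b (C c) := fun c => by simp [hf]
  have f0 : f (a (X 0)) = b (X 0) := by simp [hf]
  have f1 : f (a (X 1)) = b (X 1) := by simp [hf]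
  have f2 : f (a (X 2)) = b (X 2) := by simp [hf]
  have f3 : f (a (X 3)) = b (X 3) := by simp [hf]
  have f4 : f (a (X 4)) = b (X 4) := by simp [hf]
  have f5 : f (a (X 5)) = b (X 0) ^ p * b (X 3) * v := by simp [hf]
  have f6 : f (a (X 6)) = b (X 1) ^ q * b (X 2) * v := by simp [hf]
  have f7 : f (a (X 7)) = b (X 0) ^ p * b (X 1) ^ q * v := by simp [hf]
  have gC : ∀ c, g (b (C c)) = a (C c) := fun c => by simp [hg]
  have g0 : g (b (X 0)) = a (X 0) := by simp [hg]
  have g1 : g (b (X 1)) = a (X 1) := by simp [hg]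
  have g2 : g (b (X 2)) = a (X 2) := by simp [hg]
  have g3 : g (b (X 3)) = a (X 3) := by simp [hg]
  have g4 : g (b (X 4)) = a (X 4) := by simp [hg]
  have gv : a (X 4) * g v = 1 := by rw [← g4, ← map_mul, hv, map_one]
  have hfg : f.comp g = RingHom.id B := by
    apply extB
    apply MvPolynomial.ringHom_ext
    · intro c; simp [gC, fC]
    · intro i
      fin_cases i
      · simp [g0, f0]
      · simp [g1, f1]
      · simp [g2, f2]
      · simp [g3, f3]
      · simp [g4, f4]
  have hgf : g.comp f = RingHom.id A := by
    apply extA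
    apply MvPolynomial.ringHom_ext
    · intro c; simp [gC, fC]
    · intro i
      fin_cases i
      · simp [g0, f0]
      · simp [g1, f1]
      · simp [g2, f2]
      · simp [g3, f3]
      · simp [g4, f4]
      · suffices g (f (a (X 5))) = a (X 5) by simpa
        rw [f5]
        simp only [map_mul, map_pow, g0, g3]
        linear_combination (-g v) * r6 + a (X 5) * gv
      · suffices g (f (a (X 6))) = a (X 6) by simpa
        rw [f6]
        simp only [map_mul, map_pow, g1, g2]
        linear_combination (-g v) * r7 + a (X 6) * gv
      · suffices g (f (a (X 7))) = a (X 7) by simpa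
        rw [f7]
        simp only [map_mul, map_pow, g0, g1]
        linear_combination (-g v) * r3 + a (X 7) * gv
  refine ⟨RingEquiv.ofRingHom f g hfg hgf, ?_⟩
  simp only [RingEquiv.ofRingHom_apply]
  refine ⟨fC, f0, f1, f2, f3, f4, ?_, ?_, ?_⟩
  · rw [f5]; linear_combination b (X 0) ^ p * b (X 3) * hv
  · rw [f6]; linear_combination b (X 1) ^ q * b (X 2) * hv
  · rw [f7]; linear_combination b (X 0) ^ p * b (X 1) ^ q * hv

/-- `R[(wᵢwⱼ)⁻¹] ≅ S[(wᵢwⱼyⱼᵢ)⁻¹]` as `ℂ`-algebras, via the map fixing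
`wᵢ, wⱼ, yᵢ, yⱼ, yⱼᵢ` and sending `zᵢ ↦ wᵢᵖ yⱼ yⱼᵢ⁻¹`, `zⱼ ↦ wⱼ^q yᵢ yⱼᵢ⁻¹`,
`zⱼᵢ ↦ wᵢᵖ wⱼ^q yⱼᵢ⁻¹` (note `yⱼᵢ` is invertible in the target, since
`zⱼᵢ yⱼᵢ = wᵢᵖ wⱼ^q`; these three conditions are expressed after multiplying
through by `yⱼᵢ`).  Compatibility with the `ℂ`-algebra structures is the
condition on the constants `C c`. -/
theorem stmt8 (p q : ℕ) :
    ∃ e : Localization.Away (bowMk p q (X 0 * X 1)) ≃+*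
          Localization.Away (sMk (X 0 * X 1 * X 4)),
      (∀ c : ℂ, e (toLocR p q (C c)) = toLocS (C c)) ∧
      e (toLocR p q (X 0)) = toLocS (X 0) ∧
      e (toLocR p q (X 1)) = toLocS (X 1) ∧
      e (toLocR p q (X 2)) = toLocS (X 2) ∧
      e (toLocR p q (X 3)) = toLocS (X 3) ∧
      e (toLocR p q (X 4)) = toLocS (X 4) ∧
      e (toLocR p q (X 5)) * toLocS (X 4) = toLocS (X 0) ^ p * toLocS (X 3) ∧
      e (toLocR p q (X 6)) * toLocS (X 4) = toLocS (X 1) ^ q * toLocS (X 2) ∧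
      e (toLocR p q (X 7)) * toLocS (X 4) = toLocS (X 0) ^ p * toLocS (X 1) ^ q :=
  main_gen p q (toLocR p q) toLocS (liftR p q) liftS (extR p q) extS (relR p q) relS
    (unitR p q) unitS

end
end
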